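/- Let Qmax, Wmax, M be natural numbers and u : {0,…,Qmax} × {0,…,Wmax} × {0,…,M} → ℝ satisfy the three pairwise submodularity conditions: (a) for Q1 ≤ Q2 and a2 ≤ a1, u(Q2,W,a1) − u(Q1,W,a1) ≤ u(Q2,W,a2) − u(Q1,W,a2) for every W; (b) for W1 ≤ W2 and a2 ≤ a1, u(Q,W2,a1) − u(Q,W1,a1) ≤ u(Q,W2,a2) − u(Q,W1,a2) for every Q; (c) u(Q,W,a) = f(Q,a) + g(W,a) for some functions f, g (so the increments in Q do not depend on W). Then V(Q,W) = min over a ∈ {0,…,M} of u(Q,W,a) is submodular in (Q,W): for Q1 ≤ Q2 and W1 ≤ W2, V(Q2,W1) − V(Q1,W1) ≥ V(Q2,W2) − V(Q1,W2). -/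

import Mathlib

/-- **Minimization preserves partial submodularity.**
If `u(Q,W,a)` is submodular in `(Q,a)` and in `(W,a)`, and its increments in `Q` do not
depend on `W` (i.e. `u(Q,W,a) = f(Q,a) + g(W,a)`), then
`V(Q,W) = min_{a ∈ {0,…,M}} u(Q,W,a)` is submodular in `(Q,W)`. -/
theorem min_preserves_partial_submodularity
    (Qmax Wmax M : ℕ) (u : ℕ → ℕ → ℕ → ℝ)
    (ha : ∀ W ≤ Wmax, ∀ Q1 Q2, Q1 ≤ Q2 → Q2 ≤ Qmax → ∀ a1 a2, a2 ≤ a1 → a1 ≤ M →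
      u Q2 W a1 - u Q1 W a1 ≤ u Q2 W a2 - u Q1 W a2)
    (hb : ∀ Q ≤ Qmax, ∀ W1 W2, W1 ≤ W2 → W2 ≤ Wmax → ∀ a1 a2, a2 ≤ a1 → a1 ≤ M →
      u Q W2 a1 - u Q W1 a1 ≤ u Q W2 a2 - u Q W1 a2)
    (hc : ∃ f g : ℕ → ℕ → ℝ, ∀ Q W a, u Q W a = f Q a + g W a)
    (V : ℕ → ℕ → ℝ)
    (hV : ∀ Q W, V Q W = (Finset.Iic M).inf' Finset.nonempty_Iic (fun a => u Q W a)) :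
    ∀ Q1 Q2, Q1 ≤ Q2 → Q2 ≤ Qmax → ∀ W1 W2, W1 ≤ W2 → W2 ≤ Wmax →
      V Q2 W1 - V Q1 W1 ≥ V Q2 W2 - V Q1 W2 := by
  obtain ⟨f, g, hfg⟩ := hc
  intro Q1 Q2 hQ hQ2 W1 W2 hW hW2
  have V_le : ∀ Q W a, a ≤ M → V Q W ≤ u Q W a := fun Q W a h => by
    rw [hV]
    exact Finset.inf'_le _ (Finset.mem_Iic.2 h)
  have V_attained : ∀ Q W, ∃ a ≤ M, V Q W = u Q W a := fun Q W => by
    obtain ⟨a, h, h_eq⟩ :=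
      Finset.exists_mem_eq_inf' (Finset.nonempty_Iic (a := M)) (fun a => u Q W a)
    exact ⟨a, Finset.mem_Iic.1 h, (hV Q W).trans h_eq⟩
  obtain ⟨a, haM, hVa⟩ := V_attained Q2 W1
  obtain ⟨b, hbM, hVb⟩ := V_attained Q1 W2
  rcases le_total a b with hab | hba
  · have h := ha W1 (hW.trans hW2) Q1 Q2 hQ hQ2 b a hab hbM
    have h1 := V_le Q1 W1 a haM
    have h2 := V_le Q2 W2 b hbM
    simp only [hfg] at h h1 h2 hVa hVb
    linarith
  · have h := hb Q1 (hQ.trans hQ2) W1 W2 hW hW2 a b hba haM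
    have h1 := V_le Q1 W1 b hbM
    have h2 := V_le Q2 W2 a haM
    simp only [hfg] at h h1 h2 hVa hVb
    linarith
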